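/- The Motzkin polynomial M(x₁, x₂, x₃) = x₁⁴x₂² + x₁²x₂⁴ − 3x₁²x₂²x₃² + x₃⁶ is nonnegative on all of ℝ³, i.e. M(x) ≥ 0 for every x ∈ ℝ³, but M is not a sum of squares: there exist no real polynomials p₁, …, p_k in the variables x₁, x₂, x₃ with M = p₁² + ⋯ + p_k². -/

import Mathlib

open MvPolynomial

/-- A real multivariate polynomial is a sum of squares (SOS) if it can be written
as `p₁² + ⋯ + p_k²` for some polynomials `p₁, …, p_k`. -/
def IsSumOfSquares' (P : MvPolynomial (Fin 3) ℝ) : Prop :=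
  ∃ (k : ℕ) (p : Fin k → MvPolynomial (Fin 3) ℝ), P = ∑ i, (p i) ^ 2

/-- The Motzkin polynomial `M(x₁,x₂,x₃) = x₁⁴x₂² + x₁²x₂⁴ − 3x₁²x₂²x₃² + x₃⁶`. -/
noncomputable def motzkin : MvPolynomial (Fin 3) ℝ :=
  X 0 ^ 4 * X 1 ^ 2 + X 0 ^ 2 * X 1 ^ 4 - 3 * (X 0 ^ 2 * X 1 ^ 2 * X 2 ^ 2) + X 2 ^ 6

/-- If a sum of squares of real univariate polynomials has degree at most `2 * d`, then each
summand is the square of a polynomial of degree at most `d`. -/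
lemma natDegree_le_of_natDegree_sum_sq_le {ι : Type*} (s : Finset ι) (q : ι → Polynomial ℝ)
    (d : ℕ) (h : (∑ i ∈ s, q i ^ 2).natDegree ≤ 2 * d) {i : ι} (hi : i ∈ s) :
    (q i).natDegree ≤ d := by
  obtain ⟨j, hj, hmax⟩ := s.exists_max_image (fun i => (q i).natDegree) ⟨i, hi⟩
  refine (hmax i hi).trans ?_
  by_contra! hd
  have hcoeff : ∑ i ∈ s, (q i).coeff (q j).natDegree ^ 2 = 0 := by
    rw [← Polynomial.coeff_eq_zero_of_natDegree_lt
      (show (∑ i ∈ s, q i ^ 2).natDegree < 2 * (q j).natDegree by lia), Polynomial.finsetSum_coeff]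
    exact Finset.sum_congr rfl fun k hk =>
      (Polynomial.coeff_pow_of_natDegree_le (hmax k hk)).symm
  have hlead := (Finset.sum_eq_zero_iff_of_nonneg fun k _ => sq_nonneg _).1 hcoeff j hj
  have hzero : q j = 0 := by simpa using hlead
  simp [hzero] at hd

/-- Along the curve `t ↦ (a j * t ^ w j)`, the coefficient of `t ^ n` in `p` is the value at `a` of
the weighted homogeneous component of `p` of weight `n`. -/
lemma coeff_aeval_C_mul_X_pow {σ : Type*} (w : σ → ℕ) (a : σ → ℝ)
    (p : MvPolynomial σ ℝ) (n : ℕ) :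
    (aeval (fun j => Polynomial.C (a j) * Polynomial.X ^ w j) p).coeff n =
      eval a (weightedHomogeneousComponent w n p) := by
  classical
  induction p using MvPolynomial.induction_on' with
  | add p q hp hq => simp [hp, hq]
  | monomial m c =>
    have hcurve : aeval (fun j => Polynomial.C (a j) * Polynomial.X ^ w j) (monomial m c) =
        Polynomial.monomial (Finsupp.weight w m) (eval a (monomial m c)) := by
      rw [aeval_monomial, eval_monomial, ← Polynomial.C_mul_X_pow_eq_monomial,
        Finsupp.weight_apply, Finsupp.prod, Finsupp.prod, Finsupp.sum]
      simp [mul_pow, Finset.prod_mul_distrib, ← pow_mul, Finset.prod_pow_eq_pow_sum, mul_assoc,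
        mul_comm (w _)]
    have hw := isWeightedHomogeneous_monomial w m c rfl
    rw [hcurve, Polynomial.coeff_monomial]
    split_ifs with hn
    · subst hn
      rw [hw.weightedHomogeneousComponent_same]
    · rw [hw.weightedHomogeneousComponent_ne _ (Ne.symm hn), map_zero]

/-- If all monomials of a sum of squares have weight at most `2 * d`, then all monomials of the
squared polynomials have weight at most `d`. -/
lemma coeff_eq_zero_of_sum_sq {σ ι : Type*} (w : σ → ℕ) (d : ℕ) (s : Finset ι)
    (p : ι → MvPolynomial σ ℝ)
    (h : ∀ m, coeff m (∑ i ∈ s, p i ^ 2) ≠ 0 → Finsupp.weight w m ≤ 2 * d)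
    {i : ι} (hi : i ∈ s) {m : σ →₀ ℕ} (hm : d < Finsupp.weight w m) : coeff m (p i) = 0 := by
  classical
  have hcomp : weightedHomogeneousComponent w (Finsupp.weight w m) (p i) = 0 := by
    refine MvPolynomial.funext fun a => ?_
    rw [← coeff_aeval_C_mul_X_pow, map_zero]
    refine Polynomial.coeff_eq_zero_of_natDegree_lt (lt_of_le_of_lt ?_ hm)
    refine natDegree_le_of_natDegree_sum_sq_le s
      (fun i => aeval (fun j => Polynomial.C (a j) * Polynomial.X ^ w j) (p i)) d ?_ hi
    simp only [← map_pow, ← map_sum]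
    refine Polynomial.natDegree_le_iff_coeff_eq_zero.2 fun n hn => ?_
    have hn0 : weightedHomogeneousComponent w n (∑ i ∈ s, p i ^ 2) = 0 := by
      ext k
      rw [coeff_weightedHomogeneousComponent, coeff_zero]
      split_ifs with hk
      · by_contra hne
        have := h k hne
        lia
      · rfl
    rw [coeff_aeval_C_mul_X_pow, hn0, map_zero]
  have := congrArg (coeff m) hcomp
  rwa [coeff_weightedHomogeneousComponent, if_pos rfl, coeff_zero] at this

open Classical in
lemma coeff_motzkin (m : Fin 3 →₀ ℕ) :
    coeff m motzkin =
      (if m 0 = 4 ∧ m 1 = 2 ∧ m 2 = 0 then 1 else 0) +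
      (if m 0 = 2 ∧ m 1 = 4 ∧ m 2 = 0 then 1 else 0) -
      3 * (if m 0 = 2 ∧ m 1 = 2 ∧ m 2 = 2 then 1 else 0) +
      (if m 0 = 0 ∧ m 1 = 0 ∧ m 2 = 6 then 1 else 0) := by
  have hmon (a b c : ℕ) : coeff m (X 0 ^ a * X 1 ^ b * X 2 ^ c : MvPolynomial (Fin 3) ℝ) =
      if m 0 = a ∧ m 1 = b ∧ m 2 = c then 1 else 0 := by
    simp only [X_pow_eq_monomial, monomial_mul, mul_one, coeff_monomial]
    congr 1
    simp [Finsupp.ext_iff, Fin.forall_fin_succ, Finsupp.single_apply, eq_comm]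
  have hmotzkin : motzkin = X 0 ^ 4 * X 1 ^ 2 * X 2 ^ 0 + X 0 ^ 2 * X 1 ^ 4 * X 2 ^ 0 -
      C 3 * (X 0 ^ 2 * X 1 ^ 2 * X 2 ^ 2) + X 0 ^ 0 * X 1 ^ 0 * X 2 ^ 6 := by
    simp [motzkin, show (C 3 : MvPolynomial (Fin 3) ℝ) = 3 from map_ofNat C 3]
  rw [hmotzkin, coeff_add, coeff_sub, coeff_add, coeff_C_mul]
  simp only [hmon]

lemma motzkin_eval_nonneg (x : Fin 3 → ℝ) : 0 ≤ eval x motzkin := by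
  -- AM-GM for `u ^ 2 * v`, `u * v ^ 2` and `w ^ 3`
  have amgm (u v w : ℝ) (hu : 0 ≤ u) (hv : 0 ≤ v) (hw : 0 ≤ w) :
      0 ≤ u ^ 2 * v + u * v ^ 2 - 3 * (u * v * w) + w ^ 3 := by
    rcases le_total (3 * w) (u + v) with h | h
    · nlinarith [mul_nonneg (mul_nonneg hu hv) (sub_nonneg.2 h), pow_nonneg hw 3]
    · nlinarith [mul_nonneg (sq_nonneg (u - v)) (sub_nonneg.2 h),
        mul_nonneg (sq_nonneg (u + v - 2 * w)) (add_nonneg (add_nonneg hu hv) hw)]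
  have := amgm (x 0 ^ 2) (x 1 ^ 2) (x 2 ^ 2) (sq_nonneg _) (sq_nonneg _) (sq_nonneg _)
  simp only [motzkin, map_add, map_sub, map_mul, map_pow, eval_X, map_ofNat]
  linarith

lemma motzkin_not_isSumOfSquares : ¬ IsSumOfSquares' motzkin := by
  classical
  rintro ⟨k, p, hp⟩
  have hweight (w : Fin 3 → ℕ) (m : Fin 3 →₀ ℕ) :
      Finsupp.weight w m = m 0 * w 0 + m 1 * w 1 + m 2 * w 2 := by
    simp [Finsupp.weight_apply, Finsupp.sum_fintype, Fin.sum_univ_three]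
  have hvanish (w : Fin 3 → ℕ) (d : ℕ) (hw : 2 * w 0 + w 1 ≤ d ∧ w 0 + 2 * w 1 ≤ d ∧
      w 0 + w 1 + w 2 ≤ d ∧ 3 * w 2 ≤ d) (i : Fin k) (m : Fin 3 →₀ ℕ)
      (hm : d < m 0 * w 0 + m 1 * w 1 + m 2 * w 2) : coeff m (p i) = 0 := by
    refine coeff_eq_zero_of_sum_sq w d Finset.univ p (fun l hl => ?_) (Finset.mem_univ i)
      (by rwa [hweight])
    rw [← hp, coeff_motzkin] at hl
    rw [hweight]
    by_contra! hlt
    refine hl ?_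
    rw [if_neg, if_neg, if_neg, if_neg]
    · norm_num
    all_goals
      rintro ⟨h0, h1, h2⟩
      rw [h0, h1, h2] at hlt
      lia
  set e : Fin 3 →₀ ℕ := Finsupp.equivFunOnFinite.symm fun _ => 1 with he
  have hsq (i : Fin k) : coeff (e + e) (p i ^ 2) = coeff e (p i) ^ 2 := by
    rw [sq, coeff_mul, Finset.sum_eq_single (e, e), sq]
    · rintro ⟨l, m⟩ hlm hne
      have hsum (j : Fin 3) : l j + m j = 2 := by
        simpa [he] using DFunLike.congr_fun (Finset.HasAntidiagonal.mem_antidiagonal.1 hlm) j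
      have h0 := hsum 0
      have h1 := hsum 1
      have h2 := hsum 2
      have htotal := hvanish ![1, 1, 1] 3 (by simp) i
      have hleft := hvanish ![0, 3, 2] 6 (by simp) i
      have hright := hvanish ![3, 0, 2] 6 (by simp) i
      simp only [Matrix.cons_val] at htotal hleft hright
      by_contra hprod
      obtain ⟨hl, hm⟩ := mul_ne_zero_iff.1 hprod
      have hl1 := mt (htotal l) hl
      have hl2 := mt (hleft l) hl
      have hl3 := mt (hright l) hl
      have hm1 := mt (htotal m) hm
      have hm2 := mt (hleft m) hm
      have hm3 := mt (hright m) hm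
      refine hne (Prod.ext (Finsupp.ext fun j => ?_) (Finsupp.ext fun j => ?_)) <;>
        fin_cases j <;> simp [he] <;> lia
    · simp
  have hcoeff : coeff (e + e) motzkin = -3 := by
    rw [coeff_motzkin]
    simp [he]
  rw [hp, coeff_sum, Finset.sum_congr rfl fun i _ => hsq i] at hcoeff
  have : 0 ≤ ∑ i, coeff e (p i) ^ 2 := Finset.sum_nonneg fun i _ => sq_nonneg _
  linarith

/-- **The Motzkin polynomial is nonnegative on ℝ³ but is not a sum of squares.** -/
theorem motzkin_nonneg_not_sos :
    (∀ x : Fin 3 → ℝ, 0 ≤ MvPolynomial.eval x motzkin) ∧ ¬ IsSumOfSquares' motzkin :=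
  ⟨motzkin_eval_nonneg, motzkin_not_isSumOfSquares⟩
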